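/- Let γ = (a, b; r·q₁q₂, d) ∈ Γ₁(q₁q₂) with r ≥ 1, and let γ' = (d, −r; −b·q₁q₂, a). Then S_{χ₁,χ₂}(γ) = χ₁(−1) · S_{χ₂,χ₁}(γ'). -/

import Mathlib

open Complex Finset
open scoped Classical

/-- The sawtooth function `B₁(x)`: `0` if `x ∈ ℤ`, and `x - ⌊x⌋ - 1/2` otherwise. -/
noncomputable def sawtooth (x : ℝ) : ℝ :=
  if ∃ n : ℤ, (n : ℝ) = x then 0 else Int.fract x - 1 / 2

/-- The newform Dedekind sum `S_{χ₁,χ₂}(a, c)` associated to Dirichlet characters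
`χ₁ mod q₁` and `χ₂ mod q₂`. -/
noncomputable def newformDedekindSum {q₁ q₂ : ℕ} (χ₁ : DirichletCharacter ℂ q₁)
    (χ₂ : DirichletCharacter ℂ q₂) (a c : ℤ) : ℂ :=
  ∑ j ∈ Finset.range c.toNat, ∑ n ∈ Finset.range q₁,
    (starRingEnd ℂ) (χ₂ (j : ZMod q₂)) * (starRingEnd ℂ) (χ₁ (n : ZMod q₁)) *
      (sawtooth ((j : ℝ) / (c : ℝ)) : ℂ) *
      (sawtooth ((n : ℝ) / (q₁ : ℝ) + (a : ℝ) * (j : ℝ) / (c : ℝ)) : ℂ)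

/-- The newform Dedekind sum of a matrix `γ = (a, b; c, d) ∈ SL₂(ℤ)`:
it is `S_{χ₁,χ₂}(a, c)` if `c ≥ 1`, `S_{χ₁,χ₂}(-γ)` if `c ≤ -1`, and `0` if `c = 0`. -/
noncomputable def newformDedekindSumSL {q₁ q₂ : ℕ} (χ₁ : DirichletCharacter ℂ q₁)
    (χ₂ : DirichletCharacter ℂ q₂) (γ : Matrix.SpecialLinearGroup (Fin 2) ℤ) : ℂ :=
  if γ.1 1 0 = 0 then 0
  else if 1 ≤ γ.1 1 0 then newformDedekindSum χ₁ χ₂ (γ.1 0 0) (γ.1 1 0)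
  else newformDedekindSum χ₁ χ₂ (-(γ.1 0 0)) (-(γ.1 1 0))

/-- Membership in `Γ₀(N)`: the lower-left entry is divisible by `N`. -/
def InGamma0 (N : ℕ) (γ : Matrix.SpecialLinearGroup (Fin 2) ℤ) : Prop :=
  (N : ℤ) ∣ γ.1 1 0

/-- Membership in `Γ₁(N)`: lower-left entry divisible by `N` and both diagonal
entries congruent to `1` mod `N`. -/
def InGamma1 (N : ℕ) (γ : Matrix.SpecialLinearGroup (Fin 2) ℤ) : Prop :=
  InGamma0 N γ ∧ (N : ℤ) ∣ (γ.1 0 0 - 1) ∧ (N : ℤ) ∣ (γ.1 1 1 - 1)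

/-- `x` lies in the ring of integers `ℤ[χ₁,χ₂]` of the field `F_{χ₁,χ₂} ⊆ ℂ` generated
by the values of `χ₁` and `χ₂`: `x` lies in the subfield of `ℂ` generated by the values
of the characters and is integral over `ℤ`. -/
def InRingOfIntegers {q₁ q₂ : ℕ} (χ₁ : DirichletCharacter ℂ q₁)
    (χ₂ : DirichletCharacter ℂ q₂) (x : ℂ) : Prop :=
  x ∈ Subfield.closure (Set.range (χ₁ : ZMod q₁ → ℂ) ∪ Set.range (χ₂ : ZMod q₂ → ℂ)) ∧
    IsIntegral ℤ x

theorem sawtooth_eq_sub (x : ℝ) : sawtooth x = x - ((⌊x⌋ : ℝ) + ⌈x⌉) / 2 := by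
  unfold sawtooth
  split_ifs with h
  · obtain ⟨n, rfl⟩ := h
    simp
  · have : ⌈x⌉ = ⌊x⌋ + 1 :=
      Int.ceil_eq_floor_add_one_iff_notMem x |>.2 fun ⟨n, hn⟩ => h ⟨n, hn⟩
    rw [this, Int.fract]
    push_cast
    ring

theorem sawtooth_neg (x : ℝ) : sawtooth (-x) = -sawtooth x := by
  simp only [sawtooth_eq_sub, Int.floor_neg, Int.ceil_neg]
  push_cast
  ring

theorem sawtooth_add_intCast (x : ℝ) (n : ℤ) : sawtooth (x + n) = sawtooth x := by
  simp only [sawtooth_eq_sub, Int.floor_add_intCast, Int.ceil_add_intCast]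
  push_cast
  ring

theorem sawtooth_congr {x y : ℝ} (n : ℤ) (h : x = y + n) : sawtooth x = sawtooth y := by
  rw [h, sawtooth_add_intCast]

theorem sawtooth_intCast (n : ℤ) : sawtooth n = 0 := by
  simp [sawtooth]

theorem sawtooth_eq_of_fract_ne_zero {x : ℝ} (hx : Int.fract x ≠ 0) :
    sawtooth x = Int.fract x - 1 / 2 := by
  unfold sawtooth
  rw [if_neg]
  rintro ⟨n, rfl⟩
  simp at hx

/-- The periodic extension of `x ^ 2 - x + 1 / 4` from the unit interval. -/
noncomputable def fractQuad (x : ℝ) : ℝ := Int.fract x ^ 2 - Int.fract x + 1 / 4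

theorem fractQuad_congr {x y : ℝ} (n : ℤ) (h : x = y + n) : fractQuad x = fractQuad y := by
  rw [h, fractQuad, fractQuad, Int.fract_add_intCast]

theorem sawtooth_add_mul_sawtooth {u v : ℝ} (h : Int.fract u ≠ 0 ∨ Int.fract v ≠ 0) :
    (sawtooth u + sawtooth v) * sawtooth (u + v) = sawtooth u * sawtooth v
      + (fractQuad u + fractQuad v + fractQuad (u + v)) / 2 - 1 / 8 := by
  have key (u v : ℝ) (hu : Int.fract u = 0) (hv : Int.fract v ≠ 0) :
      (sawtooth u + sawtooth v) * sawtooth (u + v) = sawtooth u * sawtooth v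
      + (fractQuad u + fractQuad v + fractQuad (u + v)) / 2 - 1 / 8 := by
    have hu' : u = ⌊u⌋ := by linarith [Int.floor_add_fract u]
    have h1 : sawtooth (u + v) = sawtooth v := sawtooth_congr ⌊u⌋ (by linarith)
    have h2 : fractQuad (u + v) = fractQuad v := fractQuad_congr ⌊u⌋ (by linarith)
    have h3 : sawtooth u = 0 := by rw [hu', sawtooth_intCast]
    rw [h1, h2, h3, sawtooth_eq_of_fract_ne_zero hv, fractQuad, fractQuad, hu]
    ring
  by_cases hu : Int.fract u = 0
  · exact key u v hu (by tauto)
  by_cases hv : Int.fract v = 0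
  · have := key v u hv hu
    rw [add_comm v u] at this
    linarith
  rw [sawtooth_eq_of_fract_ne_zero hu, sawtooth_eq_of_fract_ne_zero hv]
  by_cases hw : Int.fract (u + v) = 0
  · have h1 : sawtooth (u + v) = 0 := by
      rw [← sawtooth_intCast ⌊u + v⌋]
      congr 1
      linarith [Int.floor_add_fract (u + v)]
    have h2 : Int.fract v = 1 - Int.fract u := by
      obtain ⟨n, hn⟩ := Int.fract_add u v
      have := Int.fract_nonneg u
      have := Int.fract_nonneg v
      have := Int.fract_lt_one u
      have := Int.fract_lt_one v
      have a1 : (-2 : ℝ) < n := by linarith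
      have a2 : (n : ℝ) < 0 := by
        have : 0 < Int.fract u := lt_of_le_of_ne (Int.fract_nonneg u) (Ne.symm hu)
        linarith
      have : n = -1 := by
        have : -2 < n := by exact_mod_cast a1
        have : n < 0 := by exact_mod_cast a2
        omega
      rw [this] at hn
      push_cast at hn
      linarith
    rw [h1, fractQuad, fractQuad, fractQuad, hw, h2]
    ring
  · obtain ⟨n, hn⟩ := Int.fract_add u v
    have := Int.fract_nonneg u
    have := Int.fract_nonneg v
    have := Int.fract_lt_one u
    have := Int.fract_lt_one v
    have := Int.fract_nonneg (u + v)
    have := Int.fract_lt_one (u + v)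
    have a1 : (-2 : ℝ) < n := by linarith
    have a2 : (n : ℝ) < 1 := by linarith
    have : n = -1 ∨ n = 0 := by
      have : -2 < n := by exact_mod_cast a1
      have : n < 1 := by exact_mod_cast a2
      omega
    have hn' : Int.fract (u + v) = Int.fract u + Int.fract v + n := by linarith
    rw [sawtooth_eq_of_fract_ne_zero hw, fractQuad, fractQuad, fractQuad, hn']
    rcases this with rfl | rfl
    · push_cast
      ring
    · push_cast
      ring

theorem sum_range_natCast_zmod {M : Type*} [AddCommMonoid M] {n : ℕ} [NeZero n]
    (g : ZMod n → M) : ∑ j ∈ range n, g (j : ZMod n) = ∑ x, g x :=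
  Finset.sum_bij' (fun j _ => (j : ZMod n)) (fun x _ => x.val)
    (by simp) (fun x _ => by simpa using x.val_lt)
    (fun j hj => ZMod.val_cast_of_lt (by simpa using hj)) (by simp) (by simp)

theorem sum_range_affine {M : Type*} [AddCommMonoid M] {n : ℕ} [NeZero n] {f : ℤ → M}
    (hf : Function.Periodic f n) {a : ℤ} (ha : IsCoprime a n) (s : ℤ) :
    ∑ j ∈ range n, f (a * j + s) = ∑ j ∈ range n, f j := by
  have hlift (k : ℤ) : f k = f ((k : ZMod n).val : ℤ) := by
    rw [ZMod.val_intCast, Int.emod_def, mul_comm]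
    exact (hf.sub_int_mul_eq _).symm
  have hu : IsUnit (a : ZMod n) := by
    obtain ⟨x, y, hxy⟩ := ha
    refine IsUnit.of_mul_eq_one (x : ZMod n) ?_
    have := congrArg (Int.cast : ℤ → ZMod n) hxy
    push_cast at this
    simpa [mul_comm] using this
  obtain ⟨w, hw⟩ := hu
  calc ∑ j ∈ range n, f (a * j + s)
      = ∑ j ∈ range n, f (((w : ZMod n) * (j : ZMod n) + s).val : ℤ) :=
        sum_congr rfl fun j _ => by rw [hlift, hw]; push_cast; rfl
    _ = ∑ x : ZMod n, f (((w : ZMod n) * x + (s : ZMod n)).val : ℤ) :=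
        sum_range_natCast_zmod fun x => f (((w : ZMod n) * x + (s : ZMod n)).val : ℤ)
    _ = ∑ x : ZMod n, f (x.val : ℤ) :=
        ((w.mulLeft).trans (Equiv.addRight (s : ZMod n))).sum_comp fun x => f (x.val : ℤ)
    _ = ∑ j ∈ range n, f j := by
        rw [← sum_range_natCast_zmod fun x : ZMod n => f (x.val : ℤ)]
        refine sum_congr rfl fun j _ => ?_
        rw [hlift j, Int.cast_natCast]

theorem sum_range_mul_eq {M : Type*} [AddCommMonoid M] (f : ℕ → M) (q h : ℕ) :
    ∑ V ∈ range (q * h), f V = ∑ n ∈ range q, ∑ i ∈ range h, f (n + q * i) := by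
  rw [sum_comm]
  induction h with
  | zero => simp
  | succ h ih =>
    rw [mul_add_one, sum_range_add, ih, sum_range_succ]
    simp only [add_comm]

theorem sum_fract_add_div {h : ℕ} (hh : 0 < h) (t : ℝ) :
    ∑ i ∈ range h, Int.fract (t + i / h) = Int.fract (h * t) + ((h : ℝ) - 1) / 2 := by
  have : NeZero h := ⟨hh.ne'⟩
  have hh' : (0 : ℝ) < h := by exact_mod_cast hh
  set s := ⌊(h : ℝ) * t⌋
  set t₀ := Int.fract ((h : ℝ) * t) / h with ht₀
  have ht : t = t₀ + s / h := by
    rw [ht₀, ← add_div, Int.fract_add_floor]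
    field_simp
  have hper : Function.Periodic (fun j : ℤ => Int.fract (t₀ + j / h)) h := fun j => by
    simp only [Int.cast_add, Int.cast_natCast]
    rw [add_div, div_self hh'.ne', ← add_assoc, Int.fract_add_one]
  have := sum_range_affine hper isCoprime_one_left s
  calc ∑ i ∈ range h, Int.fract (t + i / h)
      = ∑ i ∈ range h, Int.fract (t₀ + ((1 * (i : ℤ) + s : ℤ) : ℝ) / h) :=
        sum_congr rfl fun i _ => by
          rw [ht]
          push_cast
          congr 1
          ring
    _ = ∑ i ∈ range h, Int.fract (t₀ + ((i : ℤ) : ℝ) / h) := this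
    _ = ∑ i ∈ range h, (t₀ + (i : ℝ) / h) := by
        refine sum_congr rfl fun i hi => ?_
        have hi' : (i : ℝ) + 1 ≤ h := by exact_mod_cast mem_range.1 hi
        rw [Int.cast_natCast, Int.fract_eq_self, ht₀, ← add_div]
        have h1 := Int.fract_nonneg ((h : ℝ) * t)
        have h2 := Int.fract_lt_one ((h : ℝ) * t)
        exact ⟨by positivity, by rw [div_lt_one hh']; linarith⟩
    _ = _ := by
        have hg (k : ℕ) : ∑ i ∈ range k, (i : ℝ) = k * (k - 1) / 2 := by
          induction k with
          | zero => simp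
          | succ k ih => rw [sum_range_succ, ih]; push_cast; ring
        rw [sum_add_distrib, ← sum_div, ← sum_div, hg, sum_const, card_range, nsmul_eq_mul]
        field_simp

theorem sawtooth_eq_fract_sub_fract (x : ℝ) :
    sawtooth x = (Int.fract x - Int.fract (-x)) / 2 := by
  rw [sawtooth_eq_sub, Int.fract, Int.fract, Int.floor_neg]
  push_cast
  ring

theorem sum_sawtooth_add_div {h : ℕ} (hh : 0 < h) (t : ℝ) :
    ∑ i ∈ range h, sawtooth (t + i / h) = sawtooth (h * t) := by
  have : NeZero h := ⟨hh.ne'⟩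
  have hh' : (h : ℝ) ≠ 0 := by exact_mod_cast hh.ne'
  have hper : Function.Periodic (fun j : ℤ => Int.fract (-t + j / h)) h := fun j => by
    simp only [Int.cast_add, Int.cast_natCast]
    rw [add_div, div_self hh', ← add_assoc, Int.fract_add_one]
  have hneg : ∑ i ∈ range h, Int.fract (-(t + i / h)) = ∑ i ∈ range h, Int.fract (-t + i / h) := by
    have := sum_range_affine hper (isCoprime_one_left.neg_left) 0
    simp only [Int.cast_natCast] at this
    rw [← this]
    refine sum_congr rfl fun i _ => ?_
    push_cast
    congr 1
    ring
  simp only [sawtooth_eq_fract_sub_fract]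
  rw [← sum_div, sum_sub_distrib, hneg, sum_fract_add_div hh, sum_fract_add_div hh]
  rw [mul_neg]
  ring

/-- The character-weighted sawtooth sum `∑ n mod q, ψ(n) B₁(t + n / q)`. -/
noncomputable def charSawtooth {q : ℕ} (ψ : DirichletCharacter ℂ q) (t : ℝ) : ℂ :=
  ∑ n ∈ range q, ψ (n : ZMod q) * (sawtooth (t + n / q) : ℂ)

/-- The sum `∑ j mod |c|, ψ₂(j) B₁(j / c) (∑ n mod q₁, ψ₁(n) B₁(a j / c + n / q₁))`,
defined for `c` of either sign. -/
noncomputable def dedekindTwist {q₁ q₂ : ℕ} (ψ₁ : DirichletCharacter ℂ q₁)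
    (ψ₂ : DirichletCharacter ℂ q₂) (a c : ℤ) : ℂ :=
  ∑ j ∈ range c.natAbs,
    ψ₂ (j : ZMod q₂) * (sawtooth (j / c) : ℂ) * charSawtooth ψ₁ (a * j / c)

section charSawtooth

variable {q : ℕ} (ψ : DirichletCharacter ℂ q)

theorem intCast_apply_periodic {n : ℕ} (h : q ∣ n) :
    Function.Periodic (fun j : ℤ => ψ (j : ZMod q)) n := fun j => by
  simp [(ZMod.natCast_eq_zero_iff n q).2 h]

variable [NeZero q]

theorem sawtooth_intCast_add_div_periodic (t : ℝ) (n : ℕ) [NeZero n] :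
    Function.Periodic (fun j : ℤ => (sawtooth (t + j / n) : ℂ)) n := fun j => by
  have : (n : ℝ) ≠ 0 := NeZero.ne _
  simp only
  rw [sawtooth_congr 1]
  push_cast
  field_simp
  ring

theorem charSawtooth_neg (t : ℝ) : charSawtooth ψ (-t) = -ψ (-1) * charSawtooth ψ t := by
  have hper := (intCast_apply_periodic ψ dvd_rfl).mul (sawtooth_intCast_add_div_periodic (-t) q)
  have := sum_range_affine hper isCoprime_one_left.neg_left 0
  simp only [Pi.mul_apply, Int.cast_natCast] at this
  rw [charSawtooth, ← this, charSawtooth, mul_sum]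
  refine sum_congr rfl fun n _ => ?_
  have h1 : ((-1 * (n : ℤ) + 0 : ℤ) : ZMod q) = -1 * (n : ZMod q) := by push_cast; ring
  have h2 : -t + ((-1 * (n : ℤ) + 0 : ℤ) : ℝ) / q = -(t + n / q) := by push_cast; ring
  rw [h1, h2, map_mul, sawtooth_neg]
  push_cast
  ring

theorem sum_mul_sawtooth_add_div {h : ℕ} (hh : 0 < h) (t : ℝ) :
    ∑ V ∈ range (q * h), ψ (V : ZMod q) * (sawtooth (t + V / (q * h)) : ℂ)
      = charSawtooth ψ (h * t) := by
  have hq : (q : ℝ) ≠ 0 := NeZero.ne _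
  have hh' : (h : ℝ) ≠ 0 := by exact_mod_cast hh.ne'
  rw [sum_range_mul_eq, charSawtooth]
  refine sum_congr rfl fun n _ => ?_
  have h1 : (h : ℝ) * t + n / q = h * (t + n / (q * h)) := by field_simp
  rw [h1, ← sum_sawtooth_add_div hh, Complex.ofReal_sum, mul_sum]
  refine sum_congr rfl fun i _ => ?_
  have h2 : t + ((n + q * i : ℕ) : ℝ) / (q * h) = t + n / (q * h) + i / h := by
    push_cast
    field_simp
    ring
  rw [h2]
  simp

variable {ψ}

theorem sum_range_apply_eq_zero (hψ : ψ ≠ 1) (h : ℕ) :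
    ∑ V ∈ range (q * h), ψ (V : ZMod q) = 0 := by
  rw [sum_range_mul_eq, sum_comm]
  simp [sum_range_natCast_zmod (fun x : ZMod q => ψ x), MulChar.sum_eq_zero_of_ne_one hψ]

theorem sum_range_apply_add_mul_eq_zero (hψ : ψ ≠ 1) {h : ℕ} (hh : IsCoprime (h : ℤ) q) (V : ℤ) :
    ∑ s ∈ range q, ψ ((h * s + V : ℤ) : ZMod q) = 0 := by
  rw [sum_range_affine (intCast_apply_periodic ψ dvd_rfl) hh]
  simpa using sum_range_apply_eq_zero hψ 1

end charSawtooth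

section reciprocity

variable {q₁ q₂ : ℕ} {ψ₁ : DirichletCharacter ℂ q₁}
  {ψ₂ : DirichletCharacter ℂ q₂}

theorem apply_neg_one_mul_self (ψ : DirichletCharacter ℂ q₁) : ψ (-1) * ψ (-1) = 1 := by
  rw [← map_mul]
  simp

theorem dedekindTwist_expand (x : ℤ) {a : ℤ} :
    dedekindTwist ψ₁ ψ₂ x (q₂ * a) = ∑ m ∈ range q₂, ∑ n ∈ range q₁,
      ψ₂ (m : ZMod q₂) * ψ₁ (n : ZMod q₁) * ∑ i ∈ range a.natAbs,
        (sawtooth ((m + q₂ * (i : ℤ)) / (q₂ * a)) : ℂ) *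
          (sawtooth (x * (m + q₂ * (i : ℤ)) / (q₂ * a) + n / q₁) : ℂ) := by
  have : ((q₂ : ℤ) * a).natAbs = q₂ * a.natAbs := by simp [Int.natAbs_mul]
  rw [dedekindTwist, this, sum_range_mul_eq]
  refine sum_congr rfl fun m _ => ?_
  simp only [charSawtooth, mul_sum]
  rw [sum_comm]
  refine sum_congr rfl fun n _ => sum_congr rfl fun i _ => ?_
  have h1 : ((m + q₂ * i : ℕ) : ZMod q₂) = m := by simp
  rw [h1]
  push_cast
  ring

theorem dedekindTwist_neg_neg (a c : ℤ) :
    dedekindTwist ψ₁ ψ₂ (-a) (-c) = -dedekindTwist ψ₁ ψ₂ a c := by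
  rw [dedekindTwist, dedekindTwist, Int.natAbs_neg, ← sum_neg_distrib]
  refine sum_congr rfl fun j _ => ?_
  push_cast
  rw [div_neg, sawtooth_neg, neg_mul, neg_div_neg_eq]
  push_cast
  ring

variable [NeZero q₁]

theorem dedekindTwist_neg_left (a c : ℤ) :
    dedekindTwist ψ₁ ψ₂ (-a) c = -ψ₁ (-1) * dedekindTwist ψ₁ ψ₂ a c := by
  rw [dedekindTwist, dedekindTwist, mul_sum]
  refine sum_congr rfl fun j _ => ?_
  have : ((-a : ℤ) : ℝ) * j / c = -(a * j / c) := by push_cast; ring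
  rw [this, charSawtooth_neg]
  ring

theorem dedekindTwist_neg_right (a c : ℤ) :
    dedekindTwist ψ₁ ψ₂ a (-c) = ψ₁ (-1) * dedekindTwist ψ₁ ψ₂ a c := by
  have := dedekindTwist_neg_neg (ψ₁ := ψ₁) (ψ₂ := ψ₂) (-a) c
  rw [neg_neg] at this
  rw [this, dedekindTwist_neg_left]
  ring

variable [NeZero q₂]

theorem sum_sum_fractQuad_add_eq_zero (hψ₁ : ψ₁ ≠ 1) {h r : ℕ} (hh : 0 < h) (hr : 0 < r)
    (hcop : IsCoprime (h : ℤ) q₁) :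
    ∑ U ∈ range (q₂ * (r * q₁)), ∑ V ∈ range (q₁ * h), ψ₂ (U : ZMod q₂) * ψ₁ (V : ZMod q₁) *
      (fractQuad (U / (q₂ * (r * q₁)) + V / (q₁ * h)) : ℂ) = 0 := by
  have hq₁ : (q₁ : ℝ) ≠ 0 := NeZero.ne _
  have hq₂ : (q₂ : ℝ) ≠ 0 := NeZero.ne _
  have hh' : (h : ℝ) ≠ 0 := by exact_mod_cast hh.ne'
  have hr' : (r : ℝ) ≠ 0 := by exact_mod_cast hr.ne'
  have : NeZero (q₁ * h) := ⟨mul_ne_zero (NeZero.ne _) hh.ne'⟩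
  have : NeZero (q₂ * (r * q₁)) := ⟨mul_ne_zero (NeZero.ne _) (mul_ne_zero hr.ne' (NeZero.ne _))⟩
  have hV (t : ℝ) : Function.Periodic
      (fun j : ℤ => (fractQuad (t + j / (q₁ * h)) : ℂ)) (q₁ * h : ℕ) := fun j => by
    simp only
    rw [fractQuad_congr 1]
    push_cast
    field_simp
    ring
  have hU (t : ℝ) : Function.Periodic
      (fun j : ℤ => (fractQuad (j / (q₂ * (r * q₁)) + t) : ℂ)) (q₂ * (r * q₁) : ℕ) := fun j => by
    simp only
    rw [fractQuad_congr 1]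
    push_cast
    field_simp
    ring
  set W := ∑ U ∈ range (q₂ * (r * q₁)), ∑ V ∈ range (q₁ * h), ψ₂ (U : ZMod q₂) *
    ψ₁ (V : ZMod q₁) * (fractQuad (U / (q₂ * (r * q₁)) + V / (q₁ * h)) : ℂ) with hW
  have shift (s : ℕ) : W = ∑ V ∈ range (q₁ * h), ∑ U ∈ range (q₂ * (r * q₁)),
      ψ₂ (U : ZMod q₂) * ψ₁ ((h * s + V : ℤ) : ZMod q₁) *
        (fractQuad (U / (q₂ * (r * q₁)) + V / (q₁ * h)) : ℂ) := by
    calc W = ∑ U ∈ range (q₂ * (r * q₁)), ∑ V ∈ range (q₁ * h), ψ₂ (U : ZMod q₂) *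
          (ψ₁ ((h * s + V : ℤ) : ZMod q₁) *
            (fractQuad (U / (q₂ * (r * q₁)) + ((h * s + V : ℤ) : ℝ) / (q₁ * h)) : ℂ)) := by
          refine sum_congr rfl fun U _ => ?_
          have := sum_range_affine ((intCast_apply_periodic ψ₁ (dvd_mul_right q₁ h)).mul
            (hV (U / (q₂ * (r * q₁))))) isCoprime_one_left (h * s)
          simp only [Pi.mul_apply, Int.cast_natCast, one_mul] at this
          simp only [mul_assoc, ← mul_sum]
          rw [← this]
          simp only [add_comm]
      _ = ∑ V ∈ range (q₁ * h), ψ₁ ((h * s + V : ℤ) : ZMod q₁) *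
          ∑ U ∈ range (q₂ * (r * q₁)), ψ₂ (U : ZMod q₂) *
            (fractQuad (U / (q₂ * (r * q₁)) + ((h * s + V : ℤ) : ℝ) / (q₁ * h)) : ℂ) := by
          rw [sum_comm]
          refine sum_congr rfl fun V _ => ?_
          rw [mul_sum]
          exact sum_congr rfl fun U _ => by ring
      _ = _ := by
          refine sum_congr rfl fun V _ => ?_
          have := sum_range_affine ((intCast_apply_periodic ψ₂ (dvd_mul_right q₂ (r * q₁))).mul
            (hU (((h * s + V : ℤ) : ℝ) / (q₁ * h)))) isCoprime_one_left (-(s * r * q₂ : ℤ))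
          simp only [Pi.mul_apply, Int.cast_natCast] at this
          rw [← this, mul_sum]
          refine sum_congr rfl fun U _ => ?_
          have h1 : ((1 * (U : ℤ) + -(s * r * q₂ : ℤ) : ℤ) : ZMod q₂) = U := by
            push_cast
            simp
          have h2 : ((1 * (U : ℤ) + -(s * r * q₂ : ℤ) : ℤ) : ℝ) / (q₂ * (r * q₁)) +
              ((h * s + V : ℤ) : ℝ) / (q₁ * h) = U / (q₂ * (r * q₁)) + V / (q₁ * h) := by
            push_cast
            field_simp
            ring
          rw [h1, h2]
          ring
  have hsum : (q₁ : ℂ) * W = 0 := by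
    calc (q₁ : ℂ) * W = ∑ s ∈ range q₁, W := by simp
      _ = ∑ s ∈ range q₁, ∑ V ∈ range (q₁ * h), ∑ U ∈ range (q₂ * (r * q₁)),
          ψ₂ (U : ZMod q₂) * ψ₁ ((h * s + V : ℤ) : ZMod q₁) *
          (fractQuad (U / (q₂ * (r * q₁)) + V / (q₁ * h)) : ℂ) := sum_congr rfl fun s _ => shift s
      _ = ∑ V ∈ range (q₁ * h), ∑ U ∈ range (q₂ * (r * q₁)),
          ψ₂ (U : ZMod q₂) * (fractQuad (U / (q₂ * (r * q₁)) + V / (q₁ * h)) : ℂ) *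
          ∑ s ∈ range q₁, ψ₁ ((h * s + V : ℤ) : ZMod q₁) := by
          rw [sum_comm]
          refine sum_congr rfl fun V _ => ?_
          rw [sum_comm]
          refine sum_congr rfl fun U _ => ?_
          rw [mul_sum]
          exact sum_congr rfl fun s _ => by ring
      _ = 0 := by
          simp only [sum_range_apply_add_mul_eq_zero hψ₁ hcop, mul_zero, sum_const_zero]
  exact (mul_eq_zero.1 hsum).resolve_left (NeZero.ne _)

theorem fract_div_ne_zero_of_apply_ne_zero (hψ₂ : ψ₂ ≠ 1) {k : ℕ} (hk : 0 < k) {U : ℕ}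
    (hU : ψ₂ (U : ZMod q₂) ≠ 0) : Int.fract ((U : ℝ) / (q₂ * k)) ≠ 0 := by
  have hq₂ : (q₂ : ℝ) ≠ 0 := NeZero.ne _
  have hk' : (k : ℝ) ≠ 0 := by exact_mod_cast hk.ne'
  intro h0
  have h1 := Int.floor_add_fract ((U : ℝ) / (q₂ * k))
  rw [h0, add_zero, eq_div_iff (by positivity)] at h1
  have h2 : (⌊(U : ℝ) / (q₂ * k)⌋ : ℤ) * (q₂ * k) = (U : ℤ) := by exact_mod_cast h1
  have h3 : (U : ZMod q₂) = 0 := by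
    have := congrArg (Int.cast : ℤ → ZMod q₂) h2
    push_cast at this
    simpa using this.symm
  have hne : q₂ ≠ 1 := by
    rintro rfl
    exact hψ₂ (DirichletCharacter.level_one ψ₂)
  have : Nontrivial (ZMod q₂) := ZMod.nontrivial_iff.2 hne
  rw [h3, MulChar.map_zero] at hU
  exact hU rfl

theorem dedekindTwist_reciprocity_of_pos (hψ₁ : ψ₁ ≠ 1) (hψ₂ : ψ₂ ≠ 1) {h r : ℕ} (hh : 0 < h)
    (hr : 0 < r) (hcop : IsCoprime (h : ℤ) q₁) :
    dedekindTwist ψ₁ ψ₂ h (q₂ * (r * q₁)) + dedekindTwist ψ₂ ψ₁ (r * q₁) (q₁ * h)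
      = charSawtooth ψ₁ 0 * charSawtooth ψ₂ 0 := by
  have hq₁ : (q₁ : ℝ) ≠ 0 := NeZero.ne _
  have hq₂ : (q₂ : ℝ) ≠ 0 := NeZero.ne _
  have hh' : (h : ℝ) ≠ 0 := by exact_mod_cast hh.ne'
  have hr' : (r : ℝ) ≠ 0 := by exact_mod_cast hr.ne'
  have hrq : 0 < r * q₁ := Nat.mul_pos hr (NeZero.pos _)
  let u (U : ℕ) : ℝ := U / (q₂ * (r * q₁))
  let v (V : ℕ) : ℝ := V / (q₁ * h)
  let χ (U V : ℕ) : ℂ := ψ₂ (U : ZMod q₂) * ψ₁ (V : ZMod q₁)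
  have e₁ : dedekindTwist ψ₁ ψ₂ h (q₂ * (r * q₁)) = ∑ U ∈ range (q₂ * (r * q₁)),
      ∑ V ∈ range (q₁ * h), χ U V * ((sawtooth (u U) : ℂ) * (sawtooth (u U + v V) : ℂ)) := by
    have : ((q₂ : ℤ) * (r * q₁)).natAbs = q₂ * (r * q₁) := by norm_cast
    rw [dedekindTwist, this]
    refine sum_congr rfl fun U _ => ?_
    push_cast
    rw [mul_div_assoc, ← sum_mul_sawtooth_add_div ψ₁ hh, mul_sum]
    exact sum_congr rfl fun V _ => by simp only [χ, u, v]; ring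
  have e₂ : dedekindTwist ψ₂ ψ₁ (r * q₁) (q₁ * h) = ∑ U ∈ range (q₂ * (r * q₁)),
      ∑ V ∈ range (q₁ * h), χ U V * ((sawtooth (v V) : ℂ) * (sawtooth (u U + v V) : ℂ)) := by
    have : ((q₁ : ℤ) * h).natAbs = q₁ * h := by norm_cast
    rw [dedekindTwist, this, sum_comm]
    refine sum_congr rfl fun V _ => ?_
    have := sum_mul_sawtooth_add_div ψ₂ hrq (v V)
    push_cast at this ⊢
    rw [mul_div_assoc, ← this, mul_sum]
    exact sum_congr rfl fun U _ => by simp only [χ, u, v]; rw [add_comm]; ring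
  have e₃ : ∑ U ∈ range (q₂ * (r * q₁)), ∑ V ∈ range (q₁ * h),
      χ U V * ((sawtooth (u U) : ℂ) * (sawtooth (v V) : ℂ))
      = charSawtooth ψ₁ 0 * charSawtooth ψ₂ 0 := by
    have h1 := sum_mul_sawtooth_add_div ψ₁ hh 0
    have h2 := sum_mul_sawtooth_add_div ψ₂ hrq 0
    simp only [mul_zero, zero_add, Nat.cast_mul] at h1 h2
    rw [mul_comm (charSawtooth ψ₁ 0), ← h1, ← h2, sum_mul_sum]
    exact sum_congr rfl fun U _ => sum_congr rfl fun V _ => by simp only [χ, u, v]; ring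
  have z₁ (f : ℕ → ℂ) : ∑ U ∈ range (q₂ * (r * q₁)), ∑ V ∈ range (q₁ * h), χ U V * f U = 0 := by
    refine sum_eq_zero fun U _ => ?_
    have : ∑ V ∈ range (q₁ * h), χ U V * f U
        = ψ₂ (U : ZMod q₂) * f U * ∑ V ∈ range (q₁ * h), ψ₁ (V : ZMod q₁) := by
      rw [mul_sum]
      exact sum_congr rfl fun V _ => by simp only [χ]; ring
    rw [this, sum_range_apply_eq_zero hψ₁, mul_zero]
  have z₂ (f : ℕ → ℂ) : ∑ U ∈ range (q₂ * (r * q₁)), ∑ V ∈ range (q₁ * h), χ U V * f V = 0 := by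
    rw [sum_comm]
    refine sum_eq_zero fun V _ => ?_
    have : ∑ U ∈ range (q₂ * (r * q₁)), χ U V * f V
        = ψ₁ (V : ZMod q₁) * f V * ∑ U ∈ range (q₂ * (r * q₁)), ψ₂ (U : ZMod q₂) := by
      rw [mul_sum]
      exact sum_congr rfl fun V _ => by simp only [χ]; ring
    rw [this, sum_range_apply_eq_zero hψ₂, mul_zero]
  have z₃ : ∑ U ∈ range (q₂ * (r * q₁)), ∑ V ∈ range (q₁ * h),
      χ U V * (fractQuad (u U + v V) : ℂ) = 0 := sum_sum_fractQuad_add_eq_zero hψ₁ hh hr hcop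
  have pointwise (U V : ℕ) :
      χ U V * ((sawtooth (u U) : ℂ) * (sawtooth (u U + v V) : ℂ))
        + χ U V * ((sawtooth (v V) : ℂ) * (sawtooth (u U + v V) : ℂ))
      = χ U V * ((sawtooth (u U) : ℂ) * (sawtooth (v V) : ℂ))
        + χ U V * ((fractQuad (u U) - 1 / 4 : ℂ) / 2) + χ U V * ((fractQuad (v V) : ℂ) / 2)
        + χ U V * (fractQuad (u U + v V) : ℂ) / 2 := by
    by_cases hU : ψ₂ (U : ZMod q₂) = 0
    · simp [χ, hU]
    · have hne := fract_div_ne_zero_of_apply_ne_zero hψ₂ hrq hU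
      have key := sawtooth_add_mul_sawtooth (u := u U) (v := v V)
        (Or.inl (by simpa only [u, Nat.cast_mul] using hne))
      have key' := congrArg (Complex.ofReal) key
      push_cast at key'
      linear_combination χ U V * key'
  rw [e₁, e₂, ← e₃, ← sum_add_distrib]
  simp only [← sum_add_distrib, pointwise]
  simp only [sum_add_distrib, ← sum_div]
  rw [z₃, z₁ fun U => (fractQuad (u U) - 1 / 4 : ℂ) / 2, z₂ fun V => (fractQuad (v V) : ℂ) / 2]
  ring

theorem dedekindTwist_reciprocity (hψ₁ : ψ₁ ≠ 1) (hψ₂ : ψ₂ ≠ 1) (hpar : ψ₁ (-1) = ψ₂ (-1))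
    {a r : ℤ} (ha : a ≠ 0) (hr : r ≠ 0) (hcop : IsCoprime a q₁) :
    r.sign * dedekindTwist ψ₁ ψ₂ a (q₂ * (r * q₁))
      + a.sign * dedekindTwist ψ₂ ψ₁ (r * q₁) (q₁ * a)
      = charSawtooth ψ₁ 0 * charSawtooth ψ₂ 0 := by
  have hB : charSawtooth ψ₁ 0 = -ψ₁ (-1) * charSawtooth ψ₁ 0 := by
    simpa using charSawtooth_neg ψ₁ 0
  have main (h k : ℕ) (hh : 0 < h) (hk : 0 < k) (hc : IsCoprime (h : ℤ) q₁) :=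
    dedekindTwist_reciprocity_of_pos hψ₁ hψ₂ hh hk hc
  rcases Int.natAbs_eq a with h | h <;> rcases Int.natAbs_eq r with k | k
  all_goals
    have hh := Int.natAbs_pos.2 ha
    have hk := Int.natAbs_pos.2 hr
    have hh' : (0 : ℤ) < a.natAbs := by exact_mod_cast hh
    have hk' : (0 : ℤ) < r.natAbs := by exact_mod_cast hk
    generalize a.natAbs = x at *
    generalize r.natAbs = y at *
    subst h k
  · rw [Int.sign_eq_one_of_pos hh', Int.sign_eq_one_of_pos hk', ← main x y hh hk hcop]
    simp
  · rw [Int.sign_neg, Int.sign_eq_one_of_pos hh', Int.sign_eq_one_of_pos hk', neg_mul, mul_neg,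
      dedekindTwist_neg_right, dedekindTwist_neg_left, ← hpar, hB]
    have := main x y hh hk hcop
    push_cast
    linear_combination -ψ₁ (-1) * this
  · rw [Int.sign_neg, Int.sign_eq_one_of_pos hh', Int.sign_eq_one_of_pos hk', mul_neg,
      dedekindTwist_neg_right, dedekindTwist_neg_left, ← hpar, hB]
    have := main x y hh hk ((IsCoprime.neg_left_iff _ _).1 hcop)
    push_cast
    linear_combination -ψ₁ (-1) * this
  · rw [Int.sign_neg, Int.sign_neg, Int.sign_eq_one_of_pos hh', Int.sign_eq_one_of_pos hk', neg_mul,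
      mul_neg, mul_neg, dedekindTwist_neg_neg, dedekindTwist_neg_neg]
    have := main x y hh hk ((IsCoprime.neg_left_iff _ _).1 hcop)
    push_cast
    linear_combination this

theorem sum_range_natAbs_affine {f : ℤ → ℂ} {c : ℤ} (hc : c ≠ 0) (hf : Function.Periodic f c)
    {a : ℤ} (ha : IsCoprime a c) (s : ℤ) :
    ∑ j ∈ range c.natAbs, f (a * j + s) = ∑ j ∈ range c.natAbs, f j := by
  have : NeZero c.natAbs := ⟨Int.natAbs_ne_zero.2 hc⟩
  refine sum_range_affine ?_ ?_ s
  · rcases Int.natAbs_eq c with h | h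
    · rwa [← h]
    · rw [← neg_eq_iff_eq_neg.2 h]
      exact hf.neg
  · rcases Int.natAbs_eq c with h | h
    · rwa [← h]
    · rw [← neg_eq_iff_eq_neg.2 h]
      exact ha.neg_right

theorem dedekindTwist_inv {a d e : ℤ} (he : e ≠ 0)
    (had : (q₁ : ℤ) * (q₂ * e) ∣ a * d - 1) (ha : (q₁ : ℤ) * q₂ ∣ a - 1) :
    dedekindTwist ψ₁ ψ₂ d (q₁ * (q₂ * e)) = ψ₁ (-1) * dedekindTwist ψ₁ ψ₂ a (q₁ * (q₂ * e)) := by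
  have hq₁ : (q₁ : ℝ) ≠ 0 := NeZero.ne _
  have hq₂ : (q₂ : ℝ) ≠ 0 := NeZero.ne _
  have he' : (e : ℝ) ≠ 0 := by exact_mod_cast he
  obtain ⟨a', ha'⟩ := ha
  obtain ⟨k, hk⟩ := had
  have haR : (a : ℝ) = q₁ * q₂ * a' + 1 := by exact_mod_cast eq_add_of_sub_eq ha'
  have hadR : (a : ℝ) * d = q₁ * (q₂ * e) * k + 1 := by exact_mod_cast eq_add_of_sub_eq hk
  set C : ℤ := q₁ * (q₂ * e) with hC
  have hC0 : C ≠ 0 := by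
    have : (q₁ : ℤ) ≠ 0 := NeZero.ne _
    have : (q₂ : ℤ) ≠ 0 := NeZero.ne _
    positivity
  have hCR : (C : ℝ) = q₁ * (q₂ * e) := by rw [hC]; push_cast; ring
  have hcop : IsCoprime a C := ⟨d, -k, by linear_combination hk⟩
  have inner (n : ℕ) : ∑ j ∈ range C.natAbs, ψ₂ (j : ZMod q₂) * (sawtooth (j / C) : ℂ) *
        (sawtooth (d * j / C + n / q₁) : ℂ)
      = ∑ j ∈ range C.natAbs, ψ₂ (j : ZMod q₂) * (sawtooth (j / C) : ℂ) *
        (sawtooth (a * j / C - n / q₁) : ℂ) := by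
    let f : ℤ → ℂ := fun j => ψ₂ (j : ZMod q₂) * (sawtooth (j / C) : ℂ) *
        (sawtooth (d * j / C + n / q₁) : ℂ)
    have hf : Function.Periodic f C := fun j => by
      simp only [f]
      have h1 : ((j + C : ℤ) : ZMod q₂) = j := by rw [hC]; push_cast; simp
      rw [h1, sawtooth_congr (x := ((j + C : ℤ) : ℝ) / C) (y := j / C) 1,
        sawtooth_congr (x := d * ((j + C : ℤ) : ℝ) / C + n / q₁) (y := d * j / C + n / q₁) d]
      · push_cast
        rw [hCR]
        field_simp
        ring
      · push_cast
        rw [hCR]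
        field_simp
    have := sum_range_natAbs_affine hC0 hf hcop (-(a * n * (q₂ * e)))
    simp only [f, Int.cast_natCast] at this
    rw [← this]
    refine sum_congr rfl fun j _ => ?_
    have h1 : ((a * j + -(a * n * (q₂ * e)) : ℤ) : ZMod q₂) = j := by
      rw [eq_add_of_sub_eq ha']
      push_cast
      simp
    rw [h1, sawtooth_congr (x := ((a * j + -(a * n * (q₂ * e)) : ℤ) : ℝ) / C)
        (y := a * j / C - n / q₁) (-(q₂ * a' * n)),
      sawtooth_congr (x := d * ((a * j + -(a * n * (q₂ * e)) : ℤ) : ℝ) / C + n / q₁)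
        (y := j / C) (k * j - k * n * (q₂ * e))]
    · ring
    · push_cast
      rw [hCR]
      field_simp
      linear_combination ((j : ℝ) - n * q₂ * e) * hadR
    · push_cast
      rw [hCR]
      field_simp
      linear_combination (-n * q₂ * e : ℝ) * haR
  have outer (g : ℤ → ℕ → ℝ) : ∑ j ∈ range C.natAbs, ψ₂ (j : ZMod q₂) * (sawtooth (j / C) : ℂ) *
        ∑ n ∈ range q₁, ψ₁ (n : ZMod q₁) * (sawtooth (g j n) : ℂ)
      = ∑ n ∈ range q₁, ψ₁ (n : ZMod q₁) * ∑ j ∈ range C.natAbs,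
        ψ₂ (j : ZMod q₂) * (sawtooth (j / C) : ℂ) * (sawtooth (g j n) : ℂ) := by
    simp only [mul_sum]
    rw [sum_comm]
    exact sum_congr rfl fun n _ => sum_congr rfl fun j _ => by ring
  have hneg : ψ₁ (-1) * dedekindTwist ψ₁ ψ₂ a C = -dedekindTwist ψ₁ ψ₂ (-a) C := by
    rw [dedekindTwist_neg_left]
    ring
  have o₁ := outer fun j n => d * j / C + n / q₁
  have o₂ := outer fun j n => -a * j / C + n / q₁
  simp only [Int.cast_natCast] at o₁ o₂
  rw [hneg]
  simp only [dedekindTwist, charSawtooth, Int.cast_neg]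
  rw [o₁, o₂, ← sum_neg_distrib]
  refine sum_congr rfl fun n _ => ?_
  rw [inner, ← mul_neg, ← sum_neg_distrib]
  congr 1
  refine sum_congr rfl fun j _ => ?_
  have : (a : ℝ) * j / C - n / q₁ = -(-a * j / C + n / q₁) := by ring
  rw [this, sawtooth_neg]
  push_cast
  ring

theorem dedekindTwist_swap {a b r d : ℤ} (hdet : a * d - b * (r * (q₁ * q₂)) = 1)
    (ha : (q₁ : ℤ) * q₂ ∣ a - 1) (hd : (q₁ : ℤ) * q₂ ∣ d - 1) (ha0 : a ≠ 0) :
    dedekindTwist ψ₂ ψ₁ (r * q₁) (q₁ * a) = dedekindTwist ψ₁ ψ₂ (-b * q₂) (q₂ * a) := by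
  have hq₁ : (q₁ : ℝ) ≠ 0 := NeZero.ne _
  have hq₂ : (q₂ : ℝ) ≠ 0 := NeZero.ne _
  have ha0' : (a : ℝ) ≠ 0 := by exact_mod_cast ha0
  obtain ⟨a', ha'⟩ := ha
  obtain ⟨d', hd'⟩ := hd
  have haR : (a : ℝ) = q₁ * q₂ * a' + 1 := by exact_mod_cast eq_add_of_sub_eq ha'
  have hdR : (d : ℝ) = q₁ * q₂ * d' + 1 := by exact_mod_cast eq_add_of_sub_eq hd'
  have hdetR : (a : ℝ) * d - b * (r * (q₁ * q₂)) = 1 := by exact_mod_cast hdet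
  rw [dedekindTwist_expand, dedekindTwist_expand, sum_comm]
  refine sum_congr rfl fun m _ => sum_congr rfl fun n _ => ?_
  rw [mul_comm (ψ₁ _)]
  congr 1
  let f : ℤ → ℂ := fun j => (sawtooth ((n + q₁ * j) / (q₁ * a)) : ℂ) *
    (sawtooth ((r * q₁ : ℤ) * (n + q₁ * j) / (q₁ * a) + m / q₂) : ℂ)
  have hf : Function.Periodic f a := fun j => by
    simp only [f]
    rw [sawtooth_congr (x := (n + q₁ * ((j + a : ℤ) : ℝ)) / (q₁ * a))
        (y := (n + q₁ * j) / (q₁ * a)) 1,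
      sawtooth_congr (x := (r * q₁ : ℤ) * (n + q₁ * ((j + a : ℤ) : ℝ)) / (q₁ * a) + m / q₂)
        (y := (r * q₁ : ℤ) * (n + q₁ * j) / (q₁ * a) + m / q₂) (r * q₁)]
    · push_cast
      field_simp
      ring
    · push_cast
      field_simp
      ring
  have hcop : IsCoprime (-b * q₂) a := ⟨r * q₁, d, by linear_combination hdet⟩
  rw [← sum_range_natAbs_affine ha0 hf hcop (-b * m + n * (q₂ * a'))]
  refine sum_congr rfl fun i _ => ?_
  simp only [f]
  rw [mul_comm]
  congr 2
  · refine sawtooth_congr (r * n - d' * q₁ * m - d * i) ?_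
    push_cast
    field_simp
    linear_combination ((m : ℝ) + q₂ * i) * hdetR - a * m * hdR - r * q₂ * n * haR
  · congr 1
    push_cast
    field_simp
    linear_combination -(n : ℝ) * haR

end reciprocity

theorem newformDedekindSum_eq_dedekindTwist {q₁ q₂ : ℕ} (χ₁ : DirichletCharacter ℂ q₁)
    (χ₂ : DirichletCharacter ℂ q₂) (a c : ℤ) (hc : 0 < c) :
    newformDedekindSum χ₁ χ₂ a c = dedekindTwist χ₁⁻¹ χ₂⁻¹ a c := by
  have h1 {q : ℕ} (χ : DirichletCharacter ℂ q) (x : ZMod q) :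
      (starRingEnd ℂ) (χ x) = χ⁻¹ x := MulChar.star_apply' χ x
  have h2 : c.toNat = c.natAbs := by omega
  rw [newformDedekindSum, dedekindTwist, h2]
  refine sum_congr rfl fun j _ => ?_
  rw [charSawtooth, mul_sum]
  refine sum_congr rfl fun n _ => ?_
  rw [h1, h1, add_comm ((n : ℝ) / q₁)]
  ring

theorem newformDedekindSumSL_eq_sign_mul {q₁ q₂ : ℕ} (χ₁ : DirichletCharacter ℂ q₁)
    (χ₂ : DirichletCharacter ℂ q₂) (γ : Matrix.SpecialLinearGroup (Fin 2) ℤ) :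
    newformDedekindSumSL χ₁ χ₂ γ
      = (γ.1 1 0).sign * dedekindTwist χ₁⁻¹ χ₂⁻¹ (γ.1 0 0) (γ.1 1 0) := by
  unfold newformDedekindSumSL
  split_ifs with h0 h1
  · simp [h0]
  · rw [newformDedekindSum_eq_dedekindTwist _ _ _ _ (by omega), Int.sign_eq_one_of_pos (by omega)]
    simp
  · rw [newformDedekindSum_eq_dedekindTwist _ _ _ _ (by omega), dedekindTwist_neg_neg,
      Int.sign_eq_neg_one_of_neg (by omega)]
    simp

theorem newform_dedekind_sum_reciprocity_gamma1 {q₁ q₂ : ℕ} (hq₁ : 0 < q₁) (hq₂ : 0 < q₂)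
    (χ₁ : DirichletCharacter ℂ q₁) (χ₂ : DirichletCharacter ℂ q₂)
    (hχ₁ : χ₁ ≠ 1) (hχ₂ : χ₂ ≠ 1) (hp₁ : χ₁.IsPrimitive) (hp₂ : χ₂.IsPrimitive)
    (hpar : χ₁ (-1) * χ₂ (-1) = 1)
    (γ γ' : Matrix.SpecialLinearGroup (Fin 2) ℤ) (hγ : InGamma1 (q₁ * q₂) γ)
    (r : ℤ) (hr : 1 ≤ r) (hc : γ.1 1 0 = r * ((q₁ : ℤ) * (q₂ : ℤ)))
    (h'a : γ'.1 0 0 = γ.1 1 1) (h'b : γ'.1 0 1 = -r)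
    (h'c : γ'.1 1 0 = -(γ.1 0 1) * ((q₁ : ℤ) * (q₂ : ℤ))) (h'd : γ'.1 1 1 = γ.1 0 0) :
    newformDedekindSumSL χ₁ χ₂ γ = χ₁ (-1) * newformDedekindSumSL χ₂ χ₁ γ' := by
  have : NeZero q₁ := ⟨hq₁.ne'⟩
  have : NeZero q₂ := ⟨hq₂.ne'⟩
  obtain ⟨-, ha, hd⟩ := hγ
  rw [newformDedekindSumSL_eq_sign_mul, newformDedekindSumSL_eq_sign_mul, hc, h'a, h'c]
  have hdet := Matrix.det_fin_two γ.1
  rw [γ.2, hc] at hdet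
  generalize γ.1 0 0 = a at *
  generalize γ.1 0 1 = b at *
  generalize γ.1 1 1 = d at *
  push_cast at ha hd
  have hinv {q : ℕ} (χ : DirichletCharacter ℂ q) : χ⁻¹ (-1) = χ (-1) := by
    rw [MulChar.inv_apply_eq_inv', inv_eq_of_mul_eq_one_left (apply_neg_one_mul_self χ)]
  have hε : χ₁ (-1) = χ₂ (-1) := by
    linear_combination χ₂ (-1) * hpar - χ₁ (-1) * apply_neg_one_mul_self χ₂
  have hψ₁ : χ₁⁻¹ ≠ 1 := inv_ne_one.2 hχ₁
  have hψ₂ : χ₂⁻¹ ≠ 1 := inv_ne_one.2 hχ₂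
  have hq₁2 : 2 ≤ q₁ := by
    by_contra!
    obtain rfl : q₁ = 1 := by omega
    exact hχ₁ (DirichletCharacter.level_one χ₁)
  have hq₂2 : 2 ≤ q₂ := by
    by_contra!
    obtain rfl : q₂ = 1 := by omega
    exact hχ₂ (DirichletCharacter.level_one χ₂)
  have hN : (4 : ℤ) ≤ q₁ * q₂ := by exact_mod_cast Nat.mul_le_mul hq₁2 hq₂2
  have hNpos : (0 : ℤ) < q₁ * q₂ := by omega
  have ha0 : a ≠ 0 := by
    rintro rfl
    have := Int.le_of_dvd (by norm_num) ((dvd_neg.2 ha).trans (by norm_num : (-(0 - 1) : ℤ) ∣ 1))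
    omega
  have hcop₁ : IsCoprime a q₁ := ⟨d, -b * r * q₂, by linear_combination -hdet⟩
  have hcop₂ : IsCoprime a q₂ := ⟨d, -b * r * q₁, by linear_combination -hdet⟩
  have hdet' : a * d - b * (r * (q₁ * q₂)) = 1 := hdet.symm
  have e₁ : r * ((q₁ : ℤ) * q₂) = q₂ * (r * q₁) := by ring
  have e₂ : -b * ((q₁ : ℤ) * q₂) = q₁ * (-b * q₂) := by ring
  have s₁ : (r * ((q₁ : ℤ) * q₂)).sign = r.sign := by
    rw [Int.sign_mul, Int.sign_eq_one_of_pos hNpos, mul_one]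
  have s₂ : (-b * ((q₁ : ℤ) * q₂)).sign = (-b).sign := by
    rw [Int.sign_mul, Int.sign_eq_one_of_pos hNpos, mul_one]
  have swap := dedekindTwist_swap (ψ₁ := χ₁⁻¹) (ψ₂ := χ₂⁻¹) hdet' ha hd ha0
  have rec₁ := dedekindTwist_reciprocity hψ₁ hψ₂ (by rw [hinv, hinv, hε]) ha0 (by omega : r ≠ 0)
    hcop₁
  rw [s₁, s₂, e₁, e₂]
  by_cases hb : b = 0
  · subst hb
    have ha1 : a = 1 := by
      have : a * d = 1 := by linarith
      rcases Int.eq_one_or_neg_one_of_mul_eq_one this with h | h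
      · exact h
      · subst h
        have := Int.le_of_dvd (by norm_num) ((dvd_neg.2 ha).trans (by norm_num : (-(-1 - 1) : ℤ) ∣ 2))
        omega
    subst ha1
    have triv : dedekindTwist χ₁⁻¹ χ₂⁻¹ (-0 * q₂) (q₂ * 1)
        = charSawtooth χ₁⁻¹ 0 * charSawtooth χ₂⁻¹ 0 := by
      rw [mul_comm (charSawtooth χ₁⁻¹ 0), dedekindTwist, charSawtooth.eq_1 χ₂⁻¹, sum_mul]
      simp
    rw [swap, triv] at rec₁
    simpa using rec₁
  · have rec₂ := dedekindTwist_reciprocity hψ₂ hψ₁ (by rw [hinv, hinv, hε]) ha0 (neg_ne_zero.2 hb)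
      hcop₂
    have inv := dedekindTwist_inv (ψ₁ := χ₂⁻¹) (ψ₂ := χ₁⁻¹) (a := a) (d := d) (e := -b)
      (neg_ne_zero.2 hb) ⟨-r, by linear_combination hdet'⟩ (by rwa [mul_comm])
    rw [hinv, mul_left_comm, mul_comm (q₂ : ℤ) (-b)] at inv
    rw [swap] at rec₁
    rw [inv, ← hε]
    linear_combination rec₁ - rec₂ - (-b).sign *
      dedekindTwist χ₂⁻¹ χ₁⁻¹ a (q₁ * (-b * q₂)) * apply_neg_one_mul_self χ₁
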